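/- Let G = (I, 𝒜, E, λ) be a compact graphing. Then for almost every x ∈ I, the connected component G_x is either finite or self-dense. -/

import Mathlib

open MeasureTheory

/-- The ball of graph radius `r` around `x` in the graph `G` (as a vertex set,
including `x` itself). -/
def gball {I : Type*} (G : I → I → Prop) (x : I) : ℕ → Set I
  | 0 => {x}
  | r + 1 => gball G x r ∪ {z | ∃ w ∈ gball G x r, G w z}

/-- An `r`-neighborhood isomorphism between `x` and `y`: a rooted isomorphism of the
graph balls `B(x,r) → B(y,r)` sending `x` to `y` (encoded as a global map that is a
bijection between the balls preserving adjacency in both directions). -/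
def IsNbhdIso {I : Type*} (G : I → I → Prop) (r : ℕ) (x y : I) (φ : I → I) : Prop :=
  φ x = y ∧ Set.BijOn φ (gball G x r) (gball G y r) ∧
    ∀ u ∈ gball G x r, ∀ v ∈ gball G x r, (G u v ↔ G (φ u) (φ v))

/-- The displacement `d₀(φ) = sup_{z ∈ B(x,r)} d₀(z, φ(z))` of a neighborhood map. -/
noncomputable def disp {I : Type*} [MetricSpace I] (G : I → I → Prop) (x : I) (r : ℕ)
    (φ : I → I) : ℝ :=
  ⨆ z : gball G x r, dist (z : I) (φ z)

/-- The neighborhood-isomorphism metric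
`d(x,y) = inf over r and r-neighborhood isomorphisms φ of max {1/(r+1), d₀(φ)}`. -/
noncomputable def nbhdDist {I : Type*} [MetricSpace I] (G : I → I → Prop) (x y : I) : ℝ :=
  sInf {m | ∃ (r : ℕ) (φ : I → I), IsNbhdIso G r x y φ ∧
    m = max (1 / ((r : ℝ) + 1)) (disp G x r φ)}

/-- `degIn G B x` is the number of neighbors of `x` in `B`. -/
noncomputable def degIn {I : Type*} (G : I → I → Prop) (B : Set I) (x : I) : ℕ :=
  {y | y ∈ B ∧ G x y}.ncard

/-- The vertex set of the connected component of `x`. -/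
def compSet {I : Type*} (G : I → I → Prop) (x : I) : Set I := {y | Relation.ReflTransGen G x y}

section GrHelpers

open Set

/-- Counting measure on the neighbors of `x`. -/
noncomputable def grK {I : Type*} [MeasurableSpace I] (G : I → I → Prop) (x : I) : Measure I :=
  Measure.count.restrict {y | G x y}

/-- Points at graph distance at most `k` from `A`. -/
def grS {I : Type*} (G : I → I → Prop) (A : Set I) : ℕ → Set I
  | 0 => A
  | k + 1 => grS G A k ∪ {x | ∃ y ∈ grS G A k, G x y}

/-- Points at graph distance exactly `k` from `A`. -/
def grN {I : Type*} (G : I → I → Prop) (A : Set I) : ℕ → Set I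
  | 0 => A
  | k + 1 => grS G A (k + 1) \ grS G A k

theorem grK_apply {I : Type*} [MetricSpace I] [MeasurableSpace I] [BorelSpace I]
    (G : I → I → Prop) (hfin : ∀ x : I, {y | G x y}.Finite) (B : Set I) (hB : MeasurableSet B)
    (x : I) : grK G x B = (degIn G B x : ENNReal) := by
  have hf : (B ∩ {y | G x y}).Finite := (hfin x).subset inter_subset_right
  rw [grK, Measure.restrict_apply hB, Measure.count_apply hf.measurableSet, degIn]
  have : {y | y ∈ B ∧ G x y} = B ∩ {y | G x y} := rfl
  rw [this, ← hf.cast_ncard_eq]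
  rfl

theorem grK_lintegral {I : Type*} [MetricSpace I] [MeasurableSpace I] [BorelSpace I]
    (G : I → I → Prop) (hfin : ∀ x : I, {y | G x y}.Finite) (f : I → ENNReal) (x : I) :
    ∫⁻ y, f y ∂(grK G x) = ∑' y, {y | G x y}.indicator f y := by
  rw [grK, ← lintegral_indicator (hfin x).measurableSet, lintegral_count]

theorem grK_finite {I : Type*} [MetricSpace I] [MeasurableSpace I] [BorelSpace I]
    (G : I → I → Prop) (hfin : ∀ x : I, {y | G x y}.Finite) (x : I) :
    IsFiniteMeasure (grK G x) := by
  constructor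
  rw [grK_apply G hfin _ MeasurableSet.univ]
  exact ENNReal.natCast_lt_top _

theorem gr_mem_ball_one {I : Type*} (G : I → I → Prop) {x y : I} (h : G x y) :
    y ∈ gball G x 1 := Or.inr ⟨x, rfl, h⟩

theorem gr_self_mem {I : Type*} (G : I → I → Prop) (x : I) (r : ℕ) : x ∈ gball G x r := by
  induction r with
  | zero => rfl
  | succ n ih => exact Or.inl ih

theorem gr_ball_finite {I : Type*} (G : I → I → Prop) (hfin : ∀ x : I, {y | G x y}.Finite)
    (x : I) (r : ℕ) : (gball G x r).Finite := by
  induction r with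
  | zero => exact finite_singleton x
  | succ n ih =>
    refine ih.union ((ih.biUnion fun w _ => hfin w).subset ?_)
    rintro z ⟨w, hw, h⟩
    exact mem_biUnion hw h

theorem gr_ball_sub {I : Type*} (G : I → I → Prop) (x : I) (r : ℕ) :
    gball G x r ⊆ compSet G x := by
  induction r with
  | zero => rintro y rfl; exact Relation.ReflTransGen.refl
  | succ n ih =>
    rintro z (h | ⟨w, hw, h⟩)
    · exact ih h
    · exact Relation.ReflTransGen.tail (ih hw) h

theorem gr_comp_sub {I : Type*} (G : I → I → Prop) (x : I) {y : I} (h : y ∈ compSet G x) :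
    ∃ r, y ∈ gball G x r := by
  induction h with
  | refl => exact ⟨0, rfl⟩
  | tail _ h2 ih =>
    obtain ⟨r, hr⟩ := ih
    exact ⟨r + 1, Or.inr ⟨_, hr, h2⟩⟩

/-- measurability of the kernel -/
theorem grK_measurable {I : Type*} [MetricSpace I] [MeasurableSpace I] [BorelSpace I]
    (G : I → I → Prop) (hfin : ∀ x : I, {y | G x y}.Finite)
    (hC3 : ∀ ε > (0:ℝ), ∀ r : ℕ, ∃ δ > (0:ℝ), ∀ x y : I, dist x y ≤ δ →
      ∃ φ : I → I, IsNbhdIso G r x y φ ∧ ∀ z ∈ gball G x r, dist z (φ z) ≤ ε) :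
    Measurable (grK G) := by
  have key : ∀ U : Set I, IsOpen U → Measurable fun x => grK G x U := by
    intro U hU
    apply LowerSemicontinuous.measurable
    intro x c hc
    have hF : {y | y ∈ U ∧ G x y}.Finite := (hfin x).subset fun y hy => hy.2
    have : ∃ ε > 0, ∀ y ∈ {y | y ∈ U ∧ G x y}, Metric.closedBall y ε ⊆ U := by
      have h1 : ∀ y ∈ {y | y ∈ U ∧ G x y}, ∀ᶠ ε in nhdsWithin (0:ℝ) (Ioi 0),
          Metric.closedBall y ε ⊆ U := by
        intro y hy
        obtain ⟨ε, hε, h⟩ := Metric.nhds_basis_closedBall.mem_iff.1 (hU.mem_nhds hy.1)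
        filter_upwards [Ioo_mem_nhdsGT hε] with t ht
        exact (Metric.closedBall_subset_closedBall ht.2.le).trans h
      have h2 := (Filter.eventually_all_finite hF).2 h1
      obtain ⟨ε, h, h'⟩ := (h2.and self_mem_nhdsWithin).exists
      exact ⟨ε, h', h⟩
    obtain ⟨ε, hε, hball⟩ := this
    obtain ⟨δ, hδ, hφ⟩ := hC3 ε hε 1
    filter_upwards [Metric.ball_mem_nhds x hδ] with x' hx'
    refine lt_of_lt_of_le hc ?_
    beta_reduce
    rw [grK_apply G hfin U hU.measurableSet, grK_apply G hfin U hU.measurableSet]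
    obtain ⟨φ, ⟨h0, hb, hadj⟩, hd⟩ := hφ x x' (by rw [dist_comm]; exact (Metric.mem_ball.1 hx').le)
    norm_cast
    refine ncard_le_ncard_of_injOn φ ?_ ?_ ((hfin x').subset fun y hy => hy.2)
    · rintro y ⟨hy, hxy⟩
      refine ⟨hball y ⟨hy, hxy⟩ ?_, ?_⟩
      · rw [Metric.mem_closedBall, dist_comm]
        exact hd y (gr_mem_ball_one G hxy)
      · have := (hadj x (gr_self_mem G x 1) y (gr_mem_ball_one G hxy)).1 hxy
        rwa [h0] at this
    · exact hb.injOn.mono fun y hy => gr_mem_ball_one G hy.2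
  haveI := grK_finite G hfin
  exact Measurable.measure_of_isPiSystem (S := {s : Set I | IsOpen s})
    BorelSpace.measurable_eq isPiSystem_isOpen key (key _ isOpen_univ)

theorem grS_measurable {I : Type*} [MetricSpace I] [MeasurableSpace I] [BorelSpace I]
    (G : I → I → Prop) (hfin : ∀ x : I, {y | G x y}.Finite) (hK : Measurable (grK G))
    (A : Set I) (hA : MeasurableSet A) (k : ℕ) : MeasurableSet (grS G A k) := by
  induction k with
  | zero => exact hA
  | succ n ih =>
    refine ih.union ?_
    have : {x | ∃ y ∈ grS G A n, G x y} = {x | grK G x (grS G A n) ≠ 0} := by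
      ext x
      have hF : {y | y ∈ grS G A n ∧ G x y}.Finite := (hfin x).subset fun y hy => hy.2
      simp only [mem_setOf_eq, grK_apply G hfin _ ih, ne_eq, Nat.cast_eq_zero, degIn,
        ncard_eq_zero hF]
      rw [← ne_eq, ← nonempty_iff_ne_empty]
      rfl
    rw [this]
    exact ((Measure.measurable_coe ih).comp hK) (measurableSet_singleton 0).compl

theorem grN_measurable {I : Type*} [MetricSpace I] [MeasurableSpace I] [BorelSpace I]
    (G : I → I → Prop) (hfin : ∀ x : I, {y | G x y}.Finite) (hK : Measurable (grK G))
    (A : Set I) (hA : MeasurableSet A) (k : ℕ) : MeasurableSet (grN G A k) := by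
  cases k with
  | zero => exact hA
  | succ n => exact (grS_measurable G hfin hK A hA _).diff (grS_measurable G hfin hK A hA _)

theorem grS_mono {I : Type*} (G : I → I → Prop) (A : Set I) : Monotone (grS G A) :=
  monotone_nat_of_le_succ fun _ => subset_union_left

theorem grN_sub {I : Type*} (G : I → I → Prop) (A : Set I) (k : ℕ) :
    grN G A k ⊆ grS G A k := by
  cases k with
  | zero => exact subset_rfl
  | succ n => exact diff_subset

theorem grN_disjoint {I : Type*} (G : I → I → Prop) (A : Set I) :
    Pairwise fun n m => Disjoint (grN G A n) (grN G A m) := by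
  have h : ∀ n m, n < m → Disjoint (grN G A n) (grN G A m) := by
    intro n m hnm
    obtain ⟨m, rfl⟩ : ∃ m', m = m' + 1 := ⟨m - 1, by omega⟩
    rw [Set.disjoint_left]
    intro x hx hx'
    exact hx'.2 (grS_mono G A (Nat.lt_succ_iff.1 hnm) (grN_sub G A n hx))
  intro n m hnm
  rcases lt_or_gt_of_ne hnm with h1 | h1
  · exact h n m h1
  · exact (h m n h1).symm

theorem grN_nbr {I : Type*} (G : I → I → Prop) (hsym : Symmetric G) (A : Set I) (k : ℕ) {x : I}
    (hx : x ∈ grN G A (k + 1)) : ∃ y ∈ grN G A k, G x y := by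
  obtain ⟨h | ⟨y, hy, hxy⟩, h2⟩ := hx
  · exact absurd h h2
  · refine ⟨y, ?_, hxy⟩
    cases k with
    | zero => exact hy
    | succ n => exact ⟨hy, fun h => h2 (Or.inr ⟨y, h, hxy⟩)⟩

theorem gr_comp_closed {I : Type*} (G : I → I → Prop) {a x y : I}
    (hx : x ∈ compSet G a) (h : G x y) : y ∈ compSet G a :=
  Relation.ReflTransGen.tail hx h

theorem grN_meet {I : Type*} (G : I → I → Prop) (hsym : Symmetric G)
    (hfin : ∀ x : I, {y | G x y}.Finite) (A : Set I)
    (hone : ∀ a ∈ A, ∀ b ∈ A, b ∈ compSet G a → b = a)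
    (a : I) (ha : a ∈ A) (hinf : (compSet G a).Infinite) (k : ℕ) :
    ∃ x, x ∈ grN G A k ∩ compSet G a := by
  have hSf : ∀ k, (grS G A k ∩ compSet G a).Finite := by
    intro k
    induction k with
    | zero => exact (finite_singleton a).subset fun b hb => hone a ha b hb.1 hb.2
    | succ n ih =>
      refine (ih.union (ih.biUnion fun w _ => hfin w)).subset ?_
      rintro z ⟨h | ⟨w, hw, h⟩, hz⟩
      · exact Or.inl ⟨h, hz⟩
      · exact Or.inr (mem_biUnion (⟨hw, gr_comp_closed G hz h⟩ : w ∈ grS G A n ∩ compSet G a)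
          (hsym h))
  cases k with
  | zero => exact ⟨a, ha, Relation.ReflTransGen.refl⟩
  | succ n =>
    by_contra hcon
    push Not at hcon
    apply hinf
    refine (hSf n).subset fun x hx => ⟨?_, hx⟩
    induction hx with
    | refl => exact grS_mono G A (Nat.zero_le n) ha
    | @tail b c h1 h2 ih =>
      by_contra hc
      exact hcon c ⟨⟨Or.inr ⟨b, ih, hsym h2⟩, hc⟩, Relation.ReflTransGen.tail h1 h2⟩

theorem gr_transport {I : Type*} [MetricSpace I] [MeasurableSpace I] [BorelSpace I]
    (G : I → I → Prop) (D : ℕ) (hfin : ∀ x : I, {y | G x y}.Finite)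
    (hdeg : ∀ x : I, {y | G x y}.ncard ≤ D) (hK : Measurable (grK G))
    (μ : Measure I) [IsProbabilityMeasure μ]
    (hMP : ∀ A B : Set I, MeasurableSet A → MeasurableSet B →
      ∫ x in A, (degIn G B x : ℝ) ∂μ = ∫ x in B, (degIn G A x : ℝ) ∂μ)
    (A : Set I) (hA : MeasurableSet A) (f : I → ENNReal) (hf : Measurable f) :
    ∫⁻ y in A, ∫⁻ x, f x ∂(grK G y) ∂μ = ∫⁻ x, grK G x A * f x ∂μ := by
  have hm : ∀ B : Set I, MeasurableSet B → Measurable fun x => grK G x B :=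
    fun B hB => (Measure.measurable_coe hB).comp hK
  have hset : ∀ A B : Set I, MeasurableSet A → MeasurableSet B →
      (∫⁻ x in A, grK G x B ∂μ) ≠ ⊤ ∧
      ∫ x in A, (degIn G B x : ℝ) ∂μ = (∫⁻ x in A, grK G x B ∂μ).toReal := by
    intro A B hA hB
    constructor
    · refine ne_top_of_le_ne_top (b := ∫⁻ x in A, (D : ENNReal) ∂μ) ?_ ?_
      · rw [setLIntegral_const]
        exact ENNReal.mul_ne_top (ENNReal.natCast_ne_top _) (measure_ne_top _ _)
      · refine lintegral_mono fun x => ?_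
        rw [grK_apply G hfin B hB]
        exact Nat.cast_le.2 ((ncard_le_ncard (fun y hy => hy.2) (hfin x)).trans (hdeg x))
    · rw [← integral_toReal (hm B hB).aemeasurable]
      · simp [grK_apply G hfin B hB]
      · refine Filter.Eventually.of_forall fun x => ?_
        rw [grK_apply G hfin B hB]
        exact ENNReal.natCast_lt_top _
  have hmeas : (μ.restrict A).bind (grK G) = μ.withDensity (fun x => grK G x A) := by
    ext B hB
    rw [Measure.bind_apply hB hK.aemeasurable, withDensity_apply _ hB]
    obtain ⟨h1, h2⟩ := hset A B hA hB
    obtain ⟨h3, h4⟩ := hset B A hB hA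
    rw [← ENNReal.toReal_eq_toReal_iff' h1 h3, ← h2, ← h4]
    exact hMP A B hA hB
  rw [← Measure.lintegral_bind hK.aemeasurable hf.aemeasurable, hmeas,
    lintegral_withDensity_eq_lintegral_mul _ (hm A hA) hf]
  rfl

theorem gr_main {I : Type*} [MetricSpace I] [MeasurableSpace I] [BorelSpace I]
    (G : I → I → Prop) (hsym : Symmetric G) (D : ℕ) (hfin : ∀ x : I, {y | G x y}.Finite)
    (hdeg : ∀ x : I, {y | G x y}.ncard ≤ D) (hK : Measurable (grK G))
    (μ : Measure I) [IsProbabilityMeasure μ]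
    (hMP : ∀ A B : Set I, MeasurableSet A → MeasurableSet B →
      ∫ x in A, (degIn G B x : ℝ) ∂μ = ∫ x in B, (degIn G A x : ℝ) ∂μ)
    (A : Set I) (hA : MeasurableSet A)
    (hone : ∀ a ∈ A, ∀ b ∈ A, b ∈ compSet G a → b = a) (k : ℕ) :
    ∀ f : I → ENNReal, Measurable f →
      (∀ a ∈ A, 1 ≤ ∑' x, (grN G A k ∩ compSet G a).indicator f x) →
      μ A ≤ ∫⁻ x in grN G A k, f x ∂μ := by
  induction k with
  | zero =>
    intro f hf h
    have h1 : ∀ a ∈ A, 1 ≤ f a := by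
      intro a ha
      refine (h a ha).trans ?_
      have : grN G A 0 ∩ compSet G a = {a} := by
        ext b
        constructor
        · intro hb; exact hone a ha b hb.1 hb.2
        · rintro rfl; exact ⟨ha, Relation.ReflTransGen.refl⟩
      rw [this, tsum_eq_single a]
      · simp
      · intro b hb
        simp [hb]
    calc μ A = ∫⁻ x in A, 1 ∂μ := by simp
      _ ≤ ∫⁻ x in A, f x ∂μ := setLIntegral_mono' hA h1
  | succ k ih =>
    intro f hf h
    have hN := grN_measurable G hfin hK A hA
    set d : I → ENNReal := fun x => grK G x (grN G A k) with hd
    have hdm : Measurable d := (Measure.measurable_coe (hN k)).comp hK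
    have hdtop : ∀ x, d x ≠ ⊤ := by
      intro x
      simp only [hd, grK_apply G hfin _ (hN k)]
      exact ENNReal.natCast_ne_top _
    have hd0 : ∀ x ∈ grN G A (k + 1), d x ≠ 0 := by
      intro x hx
      have hF : {y | y ∈ grN G A k ∧ G x y}.Finite := (hfin x).subset fun y hy => hy.2
      simp only [hd, grK_apply G hfin _ (hN k), ne_eq, Nat.cast_eq_zero, degIn,
        ncard_eq_zero hF]
      rw [← ne_eq, ← nonempty_iff_ne_empty]
      exact grN_nbr G hsym A k hx
    set q : I → ENNReal := (grN G A (k + 1)).indicator (fun x => f x / d x) with hq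
    have hqm : Measurable q := (hf.div hdm).indicator (hN (k + 1))
    have hgm : Measurable fun y => ∫⁻ x, q x ∂(grK G y) :=
      (Measure.measurable_lintegral hqm).comp hK
    have hstep := ih (fun y => ∫⁻ x, q x ∂(grK G y)) hgm ?_
    · rw [gr_transport G D hfin hdeg hK μ hMP _ (hN k) q hqm] at hstep
      refine hstep.trans (le_of_eq ?_)
      rw [← lintegral_indicator (hN (k + 1))]
      refine lintegral_congr fun x => ?_
      by_cases hx : x ∈ grN G A (k + 1)
      · simp only [hq, indicator_of_mem hx]
        exact ENNReal.mul_div_cancel (hd0 x hx) (hdtop x)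
      · simp [hq, hx]
    · intro a ha
      refine (h a ha).trans ?_
      have e1 : ∀ y, (grN G A k ∩ compSet G a).indicator (fun y => ∫⁻ x, q x ∂(grK G y)) y
          = ∑' x, (grN G A k ∩ compSet G a).indicator
            (fun y => {x | G y x}.indicator q x) y := by
        intro y
        by_cases hy : y ∈ grN G A k ∩ compSet G a
        · simp only [indicator_of_mem hy]
          exact grK_lintegral G hfin q y
        · simp only [indicator_of_notMem hy, tsum_zero]
      simp_rw [e1]
      rw [ENNReal.tsum_comm]
      refine ENNReal.tsum_le_tsum fun x => ?_
      by_cases hx : x ∈ grN G A (k + 1) ∩ compSet G a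
      · rw [indicator_of_mem hx]
        have e2 : ∀ y, (grN G A k ∩ compSet G a).indicator
            (fun y => {x | G y x}.indicator q x) y
            = {y | G x y}.indicator ((grN G A k).indicator 1) y * q x := by
          intro y
          by_cases hxy : G x y
          · have hyx := hsym hxy
            have hya := gr_comp_closed G hx.2 hxy
            by_cases hy : y ∈ grN G A k <;> simp [indicator, hxy, hyx, hya, hy]
          · have hyx : ¬ G y x := fun h => hxy (hsym h)
            simp [indicator, hxy, hyx]
        simp_rw [e2]
        rw [ENNReal.tsum_mul_right, ← grK_lintegral G hfin, lintegral_indicator_one (hN k)]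
        simp only [hq, indicator_of_mem hx.1]
        exact (ENNReal.mul_div_cancel (hd0 x hx.1) (hdtop x)).ge
      · rw [indicator_of_notMem hx]; exact zero_le

theorem gr_null {I : Type*} [MetricSpace I] [MeasurableSpace I] [BorelSpace I]
    (G : I → I → Prop) (hsym : Symmetric G) (D : ℕ) (hfin : ∀ x : I, {y | G x y}.Finite)
    (hdeg : ∀ x : I, {y | G x y}.ncard ≤ D) (hK : Measurable (grK G))
    (μ : Measure I) [IsProbabilityMeasure μ]
    (hMP : ∀ A B : Set I, MeasurableSet A → MeasurableSet B →
      ∫ x in A, (degIn G B x : ℝ) ∂μ = ∫ x in B, (degIn G A x : ℝ) ∂μ)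
    (A : Set I) (hA : MeasurableSet A)
    (hone : ∀ a ∈ A, ∀ b ∈ A, b ∈ compSet G a → b = a)
    (hinf : ∀ a ∈ A, (compSet G a).Infinite) : μ A = 0 := by
  have hN := grN_measurable G hfin hK A hA
  have h1 : ∀ k, μ A ≤ μ (grN G A k) := by
    intro k
    have := gr_main G hsym D hfin hdeg hK μ hMP A hA hone k (fun _ => 1) measurable_const ?_
    · simpa using this
    · intro a ha
      obtain ⟨x, hx⟩ := grN_meet G hsym hfin A hone a ha (hinf a ha) k
      refine le_trans ?_ (ENNReal.le_tsum x)
      rw [indicator_of_mem hx]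
  by_contra h0
  have h2 : ∑' k, μ (grN G A k) = ⊤ := by
    refine top_unique ?_
    calc (⊤ : ENNReal) = ∑' _ : ℕ, μ A := (ENNReal.tsum_const_eq_top_of_ne_zero h0).symm
      _ ≤ _ := ENNReal.tsum_le_tsum h1
  rw [← measure_iUnion (grN_disjoint G A) hN] at h2
  exact measure_ne_top _ _ h2

theorem gr_inf_measurable {I : Type*} [MetricSpace I] [MeasurableSpace I] [BorelSpace I]
    (G : I → I → Prop) (hfin : ∀ x : I, {y | G x y}.Finite)
    (hC3 : ∀ ε > (0:ℝ), ∀ r : ℕ, ∃ δ > (0:ℝ), ∀ x y : I, dist x y ≤ δ →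
      ∃ φ : I → I, IsNbhdIso G r x y φ ∧ ∀ z ∈ gball G x r, dist z (φ z) ≤ ε) :
    MeasurableSet {x : I | (compSet G x).Infinite} := by
  have hiff : {x : I | (compSet G x).Infinite}ᶜ =
      ⋃ r : ℕ, {x | (gball G x (r + 1)).ncard ≤ (gball G x r).ncard} := by
    ext x
    simp only [mem_compl_iff, mem_setOf_eq, not_infinite, mem_iUnion]
    constructor
    · intro hf
      by_contra hcon
      push Not at hcon
      have hmono : StrictMono fun r => (gball G x r).ncard := strictMono_nat_of_lt_succ hcon
      have h1 := hmono.id_le ((compSet G x).ncard + 1)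
      have h2 := ncard_le_ncard (gr_ball_sub G x ((compSet G x).ncard + 1)) hf
      simp only [id] at h1
      omega
    · rintro ⟨r, hr⟩
      have heq : gball G x r = gball G x (r + 1) :=
        eq_of_subset_of_ncard_le subset_union_left hr (gr_ball_finite G hfin x _)
      refine (gr_ball_finite G hfin x r).subset fun y hy => ?_
      induction hy with
      | refl => exact gr_self_mem G x r
      | tail _ h ih => rw [heq]; exact Or.inr ⟨_, ih, h⟩
  have hcard : ∀ r x, ∀ᶠ x' in nhds x, (gball G x' r).ncard = (gball G x r).ncard := by
    intro r x
    obtain ⟨δ, hδ, hφ⟩ := hC3 1 one_pos r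
    filter_upwards [Metric.ball_mem_nhds x hδ] with x' hx'
    obtain ⟨φ, ⟨_, hb, _⟩, _⟩ := hφ x' x (Metric.mem_ball.1 hx').le
    rw [← hb.image_eq, ncard_image_of_injOn hb.injOn]
  rw [← MeasurableSet.compl_iff, hiff]
  refine MeasurableSet.iUnion fun r => IsOpen.measurableSet ?_
  rw [isOpen_iff_mem_nhds]
  intro x hx
  filter_upwards [hcard r x, hcard (r + 1) x] with x' h1 h2
  simpa only [mem_setOf_eq, h1, h2] using hx

theorem gr_iso_measurable {I : Type*} [MetricSpace I] [MeasurableSpace I] [BorelSpace I]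
    (G : I → I → Prop)
    (hC3 : ∀ ε > (0:ℝ), ∀ r : ℕ, ∃ δ > (0:ℝ), ∀ x y : I, dist x y ≤ δ →
      ∃ φ : I → I, IsNbhdIso G r x y φ ∧ ∀ z ∈ gball G x r, dist z (φ z) ≤ ε) (ε : ℝ) :
    MeasurableSet {x : I | ∀ y ∈ compSet G x, y ≠ x → ε ≤ dist x y} := by
  have : {x : I | ∀ y ∈ compSet G x, y ≠ x → ε ≤ dist x y} =
      ⋂ r : ℕ, {x : I | ∀ y ∈ gball G x r, y ≠ x → ε ≤ dist x y} := by
    ext x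
    simp only [mem_setOf_eq, mem_iInter]
    constructor
    · intro h r y hy
      exact h y (gr_ball_sub G x r hy)
    · intro h y hy
      obtain ⟨r, hr⟩ := gr_comp_sub G x hy
      exact h r y hr
  rw [this]
  refine MeasurableSet.iInter fun r => IsClosed.measurableSet ?_
  rw [← isOpen_compl_iff, isOpen_iff_mem_nhds]
  intro x hx
  simp only [mem_compl_iff, mem_setOf_eq, not_forall, not_le] at hx
  obtain ⟨y, hy, hne, hlt⟩ := hx
  obtain ⟨δ, hδ, hφ⟩ := hC3 ((ε - dist x y) / 3) (by linarith) r
  have hpos : 0 < (ε - dist x y) / 3 := by linarith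
  filter_upwards [Metric.ball_mem_nhds x hδ, Metric.ball_mem_nhds x hpos] with x' hx' hx''
  obtain ⟨φ, ⟨h0, hb, _⟩, hd⟩ := hφ x x' (by rw [dist_comm]; exact (Metric.mem_ball.1 hx').le)
  intro hcon
  have h1 := hcon (φ y) (hb.mapsTo hy) (by
    rw [← h0]
    exact fun h => hne (hb.injOn hy (gr_self_mem G x r) h))
  have h2 := hd y hy
  have h3 := Metric.mem_ball.1 hx''
  have h4 := dist_triangle4 x' x y (φ y)
  linarith

theorem gr_dense_step {I : Type*} [MetricSpace I]
    (G : I → I → Prop) (hsym : Symmetric G) (hfin : ∀ x : I, {y | G x y}.Finite)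
    (hC3 : ∀ ε > (0:ℝ), ∀ r : ℕ, ∃ δ > (0:ℝ), ∀ x y : I, dist x y ≤ δ →
      ∃ φ : I → I, IsNbhdIso G r x y φ ∧ ∀ z ∈ gball G x r, dist z (φ z) ≤ ε)
    (x y z : I) (hz : z ∈ compSet G x) (hzy : G z y)
    (h : z ∈ closure (compSet G x \ {z})) : y ∈ closure (compSet G x \ {y}) := by
  rw [Metric.mem_closure_iff]
  intro ε hε
  obtain ⟨δ, hδ, hφ⟩ := hC3 (ε / 2) (half_pos hε) 1
  have hfin' : ({w | G y w} \ {z}).Finite := (hfin y).subset diff_subset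
  have hnh : Metric.ball z δ ∩ ({w | G y w} \ {z})ᶜ ∈ nhds z := by
    refine Filter.inter_mem (Metric.ball_mem_nhds z hδ) (hfin'.isClosed.isOpen_compl.mem_nhds ?_)
    simp
  obtain ⟨w, ⟨hw1, hw2⟩, hwC, hwz⟩ := mem_closure_iff_nhds.1 h _ hnh
  obtain ⟨φ, ⟨h0, hb, hadj⟩, hd⟩ := hφ z w (by rw [dist_comm]; exact (Metric.mem_ball.1 hw1).le)
  have hy1 := gr_mem_ball_one G hzy
  have hwφ : G w (φ y) := by
    have := (hadj z (gr_self_mem G z 1) y hy1).1 hzy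
    rwa [h0] at this
  refine ⟨φ y, ⟨gr_comp_closed G hwC hwφ, ?_⟩, (hd y hy1).trans_lt (half_lt_self hε)⟩
  intro hyy
  rw [mem_singleton_iff] at hyy
  rw [hyy] at hwφ
  exact hw2 ⟨hsym hwφ, hwz⟩

end GrHelpers

/-- in a compact graphing, almost every component is finite or self-dense. -/
theorem stmt15 {I : Type*} [MetricSpace I] [CompactSpace I] [MeasurableSpace I] [BorelSpace I]
    (G : I → I → Prop) (hsym : Symmetric G) (hirr : Irreflexive G)
    (D : ℕ) (hfin : ∀ x : I, {y | G x y}.Finite) (hdeg : ∀ x : I, {y | G x y}.ncard ≤ D)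
    (hclosed : IsClosed {p : I × I | G p.1 p.2})
    (hC3 : ∀ ε > (0:ℝ), ∀ r : ℕ, ∃ δ > (0:ℝ), ∀ x y : I, dist x y ≤ δ →
      ∃ φ : I → I, IsNbhdIso G r x y φ ∧ ∀ z ∈ gball G x r, dist z (φ z) ≤ ε)
    (μ : Measure I) [IsProbabilityMeasure μ]
    (hMP : ∀ A B : Set I, MeasurableSet A → MeasurableSet B →
      ∫ x in A, (degIn G B x : ℝ) ∂μ = ∫ x in B, (degIn G A x : ℝ) ∂μ) :
    ∀ᵐ x ∂μ, (compSet G x).Finite ∨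
      ∀ y ∈ compSet G x, y ∈ closure (compSet G x \ {y}) := by
  have hK := grK_measurable G hfin hC3
  -- transversal pieces
  let T : ℕ → Set I := fun n => {x : I | ∀ y ∈ compSet G x, y ≠ x → 1 / ((n : ℝ) + 1) ≤ dist x y}
  let F : Set I := {x : I | (compSet G x).Infinite}
  have hpos : ∀ n : ℕ, (0:ℝ) < 1 / ((n : ℝ) + 1) := fun n => Nat.one_div_pos_of_nat
  have hT0 : ∀ n, μ (T n ∩ F) = 0 := by
    intro n
    obtain ⟨t, -, htf, hcov⟩ := finite_cover_balls_of_compact (isCompact_univ (X := I))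
      (half_pos (hpos n))
    have hsub : T n ∩ F ⊆ ⋃ c ∈ t, (T n ∩ F ∩ Metric.ball c (1 / ((n : ℝ) + 1) / 2)) := by
      intro x hx
      obtain ⟨c, hc, hxc⟩ := Set.mem_iUnion₂.1 (hcov (Set.mem_univ x))
      exact Set.mem_iUnion₂.2 ⟨c, hc, hx, hxc⟩
    refine measure_mono_null hsub ((measure_biUnion_null_iff htf.countable).2 fun c _ => ?_)
    refine gr_null G hsym D hfin hdeg hK μ hMP _
      (((gr_iso_measurable G hC3 _).inter (gr_inf_measurable G hfin hC3)).inter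
        Metric.isOpen_ball.measurableSet) ?_ (fun a ha => ha.1.2)
    intro a ha b hb hab
    by_contra hne
    have h1 := ha.1.1 b hab hne
    have h2 := Metric.mem_ball.1 ha.2
    have h3 := Metric.mem_ball.1 hb.2
    have h4 := dist_triangle_right a b c
    linarith
  have hall : μ (⋃ n, T n ∩ F) = 0 := measure_iUnion_null hT0
  rw [ae_iff]
  refine measure_mono_null ?_ hall
  intro x hx
  simp only [Set.mem_setOf_eq, not_or] at hx
  obtain ⟨hinf, hnd⟩ := hx
  have hxd : x ∉ closure (compSet G x \ {x}) := by
    intro hcl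
    apply hnd
    intro y hy
    induction hy with
    | refl => exact hcl
    | @tail b c h1 h2 ih => exact gr_dense_step G hsym hfin hC3 x c b h1 h2 ih
  rw [Metric.mem_closure_iff] at hxd
  push Not at hxd
  obtain ⟨ε, hε, h⟩ := hxd
  obtain ⟨n, hn⟩ := exists_nat_one_div_lt hε
  refine Set.mem_iUnion.2 ⟨n, fun y hy hne => hn.le.trans (h y ⟨hy, hne⟩), hinf⟩
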